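/- Let n ≥ 2, 0 ≤ p ≤ n/2, k ∈ ℕ, and let λ ∈ (−n/2 + p, 0) and ν ∈ (−(n−1)/2 + p, 0) satisfy λ + 1/2 − ν = −2k. Let q(ξ_1, …, ξ_n) be any Hom(Λ^p ℂ^n, Λ^p ℂ^{n−1})-valued homogeneous polynomial of degree 2k, set C = max_{|ξ|=1} ‖q(iξ_1, …, iξ_n)‖_{op} and C' = ∫_ℝ (1 + t²)^{λ+2k} dt (which is finite since λ + 2k = ν − 1/2 < −1/2). Then for every Schwartz p-form u on ℝ^n one has ∫_{ℝ^{n−1}} |ξ'|^{−2ν} ‖∫_ℝ q(iξ_1, …, iξ_n) û(ξ', ξ_n) dξ_n‖² dξ' ≤ 2π C² C' ∫_{ℝ^n} |ξ|^{−2λ} ‖û(ξ)‖² dξ. Consequently the operator u ↦ (q(∂/∂x_1, …, ∂/∂x_n) u)|_{x_n = 0} extends to a continuous linear operator Ḣ^{−λ,p}(ℝ^n) → Ḣ^{−ν,p}(ℝ^{n−1}). -/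

import Mathlib

open MeasureTheory Complex Finset

noncomputable section

/-- Euclidean space ℝ^n -/
abbrev Rn (n : ℕ) := EuclideanSpace ℝ (Fin n)

/-- The full exterior algebra Λ^•ℂ^n, realized as the Euclidean space with orthonormal
basis indexed by subsets of {1,…,n} (the basis e_S = e_{i_1}∧…∧e_{i_p}). -/
abbrev Lam (n : ℕ) := EuclideanSpace ℂ (Finset (Fin n))

variable {n : ℕ}

/-- the sign (-1)^{#{i ∈ S : i < j}} -/
def wsign (j : Fin n) (S : Finset (Fin n)) : ℂ := (-1) ^ (S.filter (· < j)).card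

/-- exterior multiplication ε_x by x ∈ ℂ^n -/
def eps (x : Fin n → ℂ) (v : Lam n) : Lam n :=
  WithLp.toLp 2 (fun S => ∑ j ∈ S, wsign j S * x j * v (S.erase j))

/-- interior multiplication i_x by x ∈ ℂ^n (adjoint of ε_x for real x) -/
def iot (x : Fin n → ℂ) (v : Lam n) : Lam n :=
  WithLp.toLp 2 (fun S => ∑ j ∈ Sᶜ, wsign j S * x j * v (insert j S))

/-- v lies in the degree-p part Λ^p ℂ^n ⊆ Λ^• ℂ^n -/
def IsForm (p : ℕ) (v : Lam n) : Prop := ∀ S, S.card ≠ p → v S = 0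

/-- complexification of a real vector -/
def rc (x : Fin n → ℝ) : Fin n → ℂ := fun j => (x j : ℂ)

/-- the j-th standard basis vector of ℂ^n -/
def ee (j : Fin n) : Fin n → ℂ := fun i => if i = j then 1 else 0

/-- extend x' ∈ ℝ^{n-1} by last coordinate t to the vector (x',t) ∈ ℝ^n -/
def app (x' : Rn (n-1)) (t : ℝ) : Rn n :=
  WithLp.toLp 2 (fun j => if h : (j : ℕ) < n - 1 then x' ⟨j, h⟩ else t)

/-- restriction ℝ^n → ℝ^{n-1}, x ↦ x' -/
def restr (ξ : Rn n) : Rn (n-1) := WithLp.toLp 2 (fun i => ξ (Fin.castLE (Nat.sub_le n 1) i))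

/-- the embedding Fin (n-1) ↪ Fin n -/
def embF : Fin (n-1) ↪ Fin n := ⟨Fin.castLE (Nat.sub_le n 1), (Fin.castLE_injective _)⟩

/-- pullback Λ^• ℂ^n → Λ^• ℂ^{n-1}; on p-forms this is the projection i_{e_n} ε_{e_n}
followed by restriction of indices. -/
def projL (v : Lam n) : Lam (n-1) := WithLp.toLp 2 (fun T => v (T.map embF))

/-- the inclusion Λ^• ℂ^{n-1} ⊆ Λ^• ℂ^n -/
def incL (v : Lam (n-1)) : Lam n :=
  WithLp.toLp 2 (fun S => ∑ T : Finset (Fin (n-1)), if T.map embF = S then v T else 0)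

/-- the operator i_z ε_z - ε_z i_z -/
def cmm (z : Fin n → ℂ) (v : Lam n) : Lam n := iot z (eps z v) - eps z (iot z v)

/-- partial derivative ∂/∂x_j -/
def pd (j : Fin n) (u : Rn n → Lam n) : Rn n → Lam n :=
  fun x => fderiv ℝ u x (EuclideanSpace.single j 1)

/-- the differential operator Δ_{a,p} = x_n²Δ + a x_n ∂_n + 2x_n(i_{e_n}d' - ε_{e_n}δ')
- (n-2p) ε_{e_n} i_{e_n}; here ℓ is the index of the last coordinate. -/
def Dap (a : ℝ) (p : ℕ) (ℓ : Fin n) (u : Rn n → Lam n) (x : Rn n) : Lam n :=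
  ((x ℓ)^2 : ℝ) • (∑ j, pd j (pd j u) x)
  + (a * x ℓ) • pd ℓ u x
  + (2 * x ℓ) • (iot (ee ℓ) (∑ j ∈ univ.erase ℓ, eps (ee j) (pd j u x))
      - eps (ee ℓ) (-(∑ j ∈ univ.erase ℓ, iot (ee j) (pd j u x))))
  - ((n : ℝ) - 2*p) • eps (ee ℓ) (iot (ee ℓ) (u x))

/-- the formal transpose of Δ_{a,p} with respect to the bilinear pairing
∫ ⟨u(x), φ(x)⟩ dx (⟨·,·⟩ the bilinear form with ⟨e_S, e_T⟩ = δ_{ST}):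
Δ_{a,p}ᵗφ = Δ(x_n²φ) - a ∂_n(x_n φ) - 2x_n Σ_j (i_{e_j}ε_{e_n} + ε_{e_j}i_{e_n}) ∂_j φ
- (n-2p) ε_{e_n} i_{e_n} φ. -/
def DapT (a : ℝ) (p : ℕ) (ℓ : Fin n) (φ : Rn n → Lam n) (x : Rn n) : Lam n :=
  (∑ j, pd j (pd j (fun y => ((y ℓ)^2 : ℝ) • φ y)) x)
  - a • pd ℓ (fun y => (y ℓ) • φ y) x
  - (2 * x ℓ) • (∑ j ∈ univ.erase ℓ,
      (iot (ee j) (eps (ee ℓ) (pd j φ x)) + eps (ee j) (iot (ee ℓ) (pd j φ x))))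
  - ((n : ℝ) - 2*p) • eps (ee ℓ) (iot (ee ℓ) (φ x))

/-- the Fourier transform with the convention û(ξ) = (2π)^{-n/2} ∫ e^{-i x·ξ} u(x) dx -/
def ft (u : Rn n → Lam n) : Rn n → Lam n := fun ξ =>
  ((2 * Real.pi) ^ (-(n:ℝ)/2) : ℝ) •
    ∫ x, Complex.exp (-(((∑ j, x j * ξ j : ℝ) : ℂ) * Complex.I)) • u x

/-- the inverse Fourier transform -/
def ftInv (u : Rn n → Lam n) : Rn n → Lam n := fun ξ =>
  ((2 * Real.pi) ^ (-(n:ℝ)/2) : ℝ) •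
    ∫ x, Complex.exp ((((∑ j, x j * ξ j : ℝ) : ℂ) * Complex.I)) • u x

/-- The homogeneous Sobolev space Ḣ^{s,p}(ℝ^n) of Λ^pℂ^n-valued tempered distributions,
modeled on the Fourier transform side: an element of the set is the function g = û. -/
def Hdot (n : ℕ) (s : ℝ) (p : ℕ) : Set (Rn n → Lam n) :=
  {g | AEStronglyMeasurable g volume ∧ (∀ ξ, IsForm p (g ξ)) ∧
    Integrable (fun ξ => ‖ξ‖ ^ (2*s) * ‖g ξ‖^2)}

/-- squared weighted L² norm ∫ ‖ξ‖^t ‖g(ξ)‖² dξ on the Fourier side;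
wInt (2s) g is the squared homogeneous Sobolev norm of degree s of u with û = g. -/
def wInt (t : ℝ) (g : Rn n → Lam n) : ℝ := ∫ ξ, ‖ξ‖ ^ t * ‖g ξ‖^2

/-- the operator (c - λ) i_x ε_x + (c + λ) ε_x i_x on Λ^•ℂ^n -/
def opC (c lam : ℝ) (x : Fin n → ℝ) (v : Lam n) : Lam n :=
  ((c - lam : ℝ) : ℂ) • iot (rc x) (eps (rc x) v)
    + ((c + lam : ℝ) : ℂ) • eps (rc x) (iot (rc x) v)

/-- the conformally invariant squared norm ‖u‖_λ² on the Fourier side (for û = g);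
c is dim/2 - p, i.e. n/2 - p on ℝ^n and (n-1)/2 - p on ℝ^{n-1}. -/
def cSq (c lam : ℝ) (g : Rn n → Lam n) : ℝ :=
  ∫ ξ, ‖ξ‖ ^ (-(2*lam)) * (inner ℂ (g ξ) (opC c lam (‖ξ‖⁻¹ • ξ) (g ξ)) : ℂ).re

/-- the conformally invariant inner product on the Fourier side -/
def cIp (c lam : ℝ) (g h : Rn n → Lam n) : ℂ :=
  ∫ ξ, (‖ξ‖ ^ (-(2*lam)) : ℝ) • (inner ℂ (g ξ) (opC c lam (‖ξ‖⁻¹ • ξ) (h ξ)) : ℂ)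

/-- the bilinear pairing on Λ^•ℂ^n with ⟨e_S, e_T⟩ = δ_{ST} -/
def blin (v w : Lam n) : ℂ := ∑ S, v S * w S

/-- the pairing ⟨u, ψ⟩ of the tempered distribution u whose Fourier transform is g
with a Schwartz function ψ: ⟨u, ψ⟩ = ⟨û, 𝓕⁻¹ψ⟩ = ∫ ⟨g(ξ), (𝓕⁻¹ψ)(ξ)⟩ dξ. -/
def dpair (g : Rn n → Lam n) (ψ : Rn n → Lam n) : ℂ :=
  ∫ ξ, blin (g ξ) (ftInv ψ ξ)

/-- "Δ_{a,p} u = μ u in the sense of tempered distributions", expressed for the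
distribution u whose Fourier transform is g: testing against all Λ^•ℂ^n-valued
Schwartz functions φ via the formal transpose of Δ_{a,p}. -/
def WeakEig (a : ℝ) (p : ℕ) (ℓ : Fin n) (g : Rn n → Lam n) (μ : ℂ) : Prop :=
  ∀ φ : SchwartzMap (Rn n) (Lam n),
    dpair g (fun x => DapT a p ℓ (fun y => φ y) x - μ • φ x) = 0

/-- the Fourier side of the trace map u ↦ u|_{ℝ^{n-1}}:
(Ru)^(ξ') = (2π)^{-1/2} ∫_ℝ û(ξ', ξ_n) dξ_n, composed with the pullback
Λ^pℂ^n → Λ^pℂ^{n-1}. -/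
def ftrace (g : Rn n → Lam n) : Rn (n-1) → Lam (n-1) := fun ξ' =>
  ((2 * Real.pi) ^ (-(1:ℝ)/2) : ℝ) • ∫ t : ℝ, projL (g (app ξ' t))

/-- the constant c_{a,p} -/
def cP (n p : ℕ) (a : ℝ) : ℝ :=
  2 * Real.Gamma (((n:ℝ) - a + 2)/2) /
    (Real.pi ^ (((n:ℝ)-1)/2) * ((n:ℝ) - 2*p - a) * Real.Gamma ((1-a)/2))

/-- the Poisson transform P_{a,p}f(x) = c_{a,p} ∫_{ℝ^{n-1}} |x_n|^{1-a}
(|x'-y|²+x_n²)^{-(n-a+2)/2} (i_{x-y}ε_{x-y} - ε_{x-y}i_{x-y}) f(y) dy,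
where ℓ is the index of the last coordinate. -/
def Pois (a : ℝ) (p : ℕ) (ℓ : Fin n) (f : Rn (n-1) → Lam (n-1)) (x : Rn n) : Lam n :=
  cP n p a • ∫ y : Rn (n-1),
    (|x ℓ| ^ (1-a) * ‖x - app y 0‖ ^ (-((n:ℝ) - a + 2))) •
      cmm (rc (x - app y 0)) (incL (f y))

/-- "G is the Fourier transform of the (polynomially bounded, locally integrable)
function u in the sense of tempered distributions":
∫ ⟨G(ξ), ψ(ξ)⟩ dξ = ∫ ⟨u(x), ψ̂(x)⟩ dx for every Schwartz function ψ. -/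
def IsFTof (G : Rn n → Lam n) (u : Rn n → Lam n) : Prop :=
  ∀ ψ : SchwartzMap (Rn n) (Lam n),
    ∫ ξ, blin (G ξ) (ψ ξ) = ∫ x, blin (u x) (ft (fun y => ψ y) x)

/-- the splitting ℝ^m × ℝ → ℝ^{m+1} preserves Lebesgue measure -/
theorem mp_app (m : ℕ) : MeasurePreserving
    (fun z : Rn (m+1-1) × ℝ => (app z.1 z.2 : Rn (m+1))) (volume.prod volume) volume := by
  have h1 : MeasurePreserving (WithLp.ofLp : Rn m → (Fin m → ℝ)) volume volume :=
    PiLp.volume_preserving_ofLp (Fin m)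
  have h2 := (MeasurePreserving.id (volume : Measure ℝ)).prod h1
  have h3 := (volume_preserving_piFinSuccAbove (fun _ : Fin (m+1) => ℝ) (Fin.last m)).symm
  have h4 := PiLp.volume_preserving_toLp (Fin (m+1))
  have h5 : MeasurePreserving (Prod.swap : Rn m × ℝ → ℝ × Rn m)
    (volume.prod volume) (volume.prod volume) := Measure.measurePreserving_swap
  have h6 := h4.comp (h3.comp (h2.comp h5))
  suffices h7 : (fun z : Rn (m+1-1) × ℝ => (app z.1 z.2 : Rn (m+1))) = (WithLp.toLp 2 ∘
      ⇑(MeasurableEquiv.piFinSuccAbove (fun _ : Fin (m+1) => ℝ) (Fin.last m)).symm ∘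
        Prod.map id WithLp.ofLp ∘ (Prod.swap : Rn m × ℝ → ℝ × Rn m)) by
    rw [h7]
    exact h6
  funext z
  ext j
  refine Fin.lastCases ?_ (fun i => ?_) j
  · simp [app, MeasurableEquiv.piFinSuccAbove]
  · simp [app, MeasurableEquiv.piFinSuccAbove]

theorem norm_app_sq (m : ℕ) (x : Rn (m+1-1)) (t : ℝ) :
    ‖(app x t : Rn (m+1))‖^2 = ‖x‖^2 + t^2 := by
  have hx : ‖x‖^2 = ∑ i : Fin m, ‖x i‖^2 := EuclideanSpace.norm_sq_eq x
  rw [EuclideanSpace.norm_sq_eq, Fin.sum_univ_castSucc, hx]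
  simp [app]

theorem eval_smul_hom {σ : Type*} (P : MvPolynomial σ ℂ) (N : ℕ)
    (hP : P.IsHomogeneous N) (c : ℂ) (x : σ → ℂ) :
    MvPolynomial.eval (fun j => c * x j) P = c^N * MvPolynomial.eval x P := by
  rw [MvPolynomial.eval_eq, MvPolynomial.eval_eq, Finset.mul_sum]
  refine Finset.sum_congr rfl fun d hd => ?_
  have hdeg : ∑ i ∈ d.support, d i = N := by
    have := hP (MvPolynomial.mem_support_iff.mp hd)
    rw [← this, Finsupp.weight_apply]
    simp [Finsupp.sum]
  simp_rw [mul_pow, Finset.prod_mul_distrib, Finset.prod_pow_eq_pow_sum, hdeg]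
  ring

/-- homogeneity of the symbol and the bound on the sphere give the bound everywhere -/
theorem q_bound (n k : ℕ) (q : (Fin n → ℂ) → (Lam n →ₗ[ℂ] Lam (n-1)))
    (hqpoly : ∀ (v : Lam n) (S : Finset (Fin (n-1))), ∃ P : MvPolynomial (Fin n) ℂ,
      P.IsHomogeneous (2*k) ∧ ∀ ξ : Fin n → ℂ, (q ξ) v S = MvPolynomial.eval ξ P)
    (C : ℝ)
    (hC : ∀ ξ : Rn n, ‖ξ‖ = 1 → ∀ v : Lam n, ‖(q (fun j => Complex.I * (ξ j : ℂ))) v‖ ≤ C * ‖v‖)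
    (ξ : Rn n) (hξ : ξ ≠ 0) (v : Lam n) :
    ‖(q (fun j => Complex.I * (ξ j : ℂ))) v‖ ≤ C * ‖ξ‖^(2*k) * ‖v‖ := by
  have hpos : 0 < ‖ξ‖ := norm_pos_iff.mpr hξ
  have h1 : ‖(‖ξ‖⁻¹ • ξ)‖ = 1 := by
    rw [norm_smul, norm_inv, norm_norm, inv_mul_cancel₀ hpos.ne']
  have h2 : q (fun j => Complex.I * (ξ j : ℂ)) v =
      ((‖ξ‖ : ℂ)^(2*k)) • q (fun j => Complex.I * (((‖ξ‖⁻¹ • ξ) j : ℝ) : ℂ)) v := by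
    ext S
    obtain ⟨P, hP, hq⟩ := hqpoly v S
    rw [PiLp.smul_apply, hq, hq, smul_eq_mul, ← eval_smul_hom P _ hP]
    congr 2
    funext j
    have : (‖ξ‖ : ℂ) ≠ 0 := by exact_mod_cast hpos.ne'
    simp
    field_simp
  rw [h2, norm_smul, norm_pow, Complex.norm_real, norm_norm]
  have := hC _ h1 v
  calc _ ≤ ‖ξ‖^(2*k) * (C * ‖v‖) := by gcongr
    _ = _ := by ring

theorem q_meas (n k : ℕ) (q : (Fin n → ℂ) → (Lam n →ₗ[ℂ] Lam (n-1)))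
    (hqpoly : ∀ (v : Lam n) (S : Finset (Fin (n-1))), ∃ P : MvPolynomial (Fin n) ℂ,
      P.IsHomogeneous (2*k) ∧ ∀ ξ : Fin n → ℂ, (q ξ) v S = MvPolynomial.eval ξ P)
    (g : Rn n → Lam n) (hg : AEStronglyMeasurable g volume) :
    AEStronglyMeasurable (fun ξ : Rn n => (q (fun j => Complex.I * (ξ j : ℂ))) (g ξ)) volume := by
  have h1 : ∀ ξ : Rn n, (q (fun j => Complex.I * (ξ j : ℂ))) (g ξ) =
      ∑ S, (g ξ) S • (q (fun j => Complex.I * (ξ j : ℂ))) (EuclideanSpace.single S 1) := by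
    intro ξ
    have : g ξ = ∑ S, (g ξ) S • (EuclideanSpace.single S (1:ℂ) : Lam n) := by
      have := (EuclideanSpace.basisFun (Finset (Fin n)) ℂ).sum_repr (g ξ)
      simpa using this.symm
    conv_lhs => rw [this]
    rw [map_sum]
    simp only [map_smul]
  simp_rw [h1]
  refine Finset.aestronglyMeasurable_fun_sum _ fun S _ => ?_
  refine AEStronglyMeasurable.smul (f := fun ξ => g ξ S) ?_ ?_
  · exact (Continuous.comp_aestronglyMeasurable (g := fun v : Lam n => v S) (by fun_prop) hg)
  · refine Continuous.aestronglyMeasurable ?_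
    rw [← (PiLp.homeomorph 2 (fun _ : Finset (Fin (n-1)) => ℂ)).comp_continuous_iff]
    refine continuous_pi fun T => ?_
    obtain ⟨P, hP, hq⟩ := hqpoly (EuclideanSpace.single S 1) T
    have : Continuous fun ξ : Rn n => MvPolynomial.eval (fun j => Complex.I * (ξ j : ℂ)) P :=
      (MvPolynomial.continuous_eval P).comp (by fun_prop)
    convert this using 2 with ξ
    exact hq _

theorem int_weight (s : ℝ) (hs : s < -1/2) : Integrable (fun t : ℝ => (1 + t^2)^s) := by
  have := integrable_rpow_neg_one_add_norm_sq (E := ℝ) (μ := volume) (r := -2*s)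
    (by simp; linarith)
  convert this using 2 with t
  simp

theorem lint_weight (s r : ℝ) (hs : s < -1/2) (hr : 0 < r) :
    ∫⁻ t : ℝ, ENNReal.ofReal ((r^2 + t^2)^s) =
      ENNReal.ofReal (r^(2*s+1) * ∫ t : ℝ, (1+t^2)^s) := by
  have h0 : ∀ t : ℝ, (r^2+t^2)^s = r^(2*s) * (1 + (t/r)^2)^s := by
    intro t
    rw [show r^(2*s) = (r^2)^s by rw [Real.rpow_mul hr.le]; norm_cast,
      ← Real.mul_rpow (by positivity) (by positivity)]
    congr 1
    field_simp
  have hi : Integrable (fun t : ℝ => (r^2 + t^2)^s) := by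
    simp_rw [h0]
    exact ((int_weight s hs).comp_div hr.ne').const_mul _
  rw [← ofReal_integral_eq_lintegral_ofReal hi (Filter.Eventually.of_forall fun t => by positivity)]
  congr 1
  simp_rw [h0]
  rw [integral_const_mul, Measure.integral_comp_div (fun t : ℝ => (1 + t^2)^s) r, abs_of_pos hr,
    smul_eq_mul, Real.rpow_add_one hr.ne']
  ring

theorem lint_cs (f g : ℝ → ENNReal) (hf : AEMeasurable f) (hg : AEMeasurable g) :
    (∫⁻ t, f t * g t)^2 ≤ (∫⁻ t, f t^2) * ∫⁻ t, g t^2 := by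
  have h := ENNReal.lintegral_mul_le_Lp_mul_Lq volume Real.HolderConjugate.two_two hf hg
  simp only [Pi.mul_apply, ENNReal.rpow_two] at h
  calc _ ≤ ((∫⁻ t, f t^2)^((1:ℝ)/2) * (∫⁻ t, g t^2)^((1:ℝ)/2))^2 := by gcongr
    _ = _ := by
      rw [mul_pow, ← ENNReal.rpow_two, ← ENNReal.rpow_two, ← ENNReal.rpow_mul, ← ENNReal.rpow_mul]
      norm_num

theorem q_comp_meas (m k : ℕ)
    (q : (Fin (m+1) → ℂ) → (Lam (m+1) →ₗ[ℂ] Lam (m+1-1)))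
    (hqpoly : ∀ (v : Lam (m+1)) (S : Finset (Fin (m+1-1))), ∃ P : MvPolynomial (Fin (m+1)) ℂ,
      P.IsHomogeneous (2*k) ∧ ∀ ξ : Fin (m+1) → ℂ, (q ξ) v S = MvPolynomial.eval ξ P)
    (g : Rn (m+1) → Lam (m+1)) (hg : AEStronglyMeasurable g volume) :
    AEStronglyMeasurable (fun ξ' : Rn (m+1-1) =>
      ∫ t : ℝ, (q (fun j => Complex.I * ((app ξ' t) j : ℂ))) (g (app ξ' t))) volume := by
  have := (q_meas (m+1) k q hqpoly g hg).comp_measurePreserving (mp_app m)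
  exact this.integral_prod_right'

theorem key (m k : ℕ) (lam nu : ℝ) (hnu2 : nu < 0)
    (hk : lam + 1/2 - nu = -(2*(k:ℝ)))
    (q : (Fin (m+1) → ℂ) → (Lam (m+1) →ₗ[ℂ] Lam (m+1-1)))
    (hqpoly : ∀ (v : Lam (m+1)) (S : Finset (Fin (m+1-1))), ∃ P : MvPolynomial (Fin (m+1)) ℂ,
      P.IsHomogeneous (2*k) ∧ ∀ ξ : Fin (m+1) → ℂ, (q ξ) v S = MvPolynomial.eval ξ P)
    (C : ℝ) (hC0 : 0 ≤ C)
    (hC : ∀ ξ : Rn (m+1), ‖ξ‖ = 1 → ∀ v : Lam (m+1),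
      ‖(q (fun j => Complex.I * (ξ j : ℂ))) v‖ ≤ C * ‖v‖)
    (g : Rn (m+1) → Lam (m+1)) (hg : AEStronglyMeasurable g volume) :
    ∫⁻ ξ' : Rn (m+1-1), ENNReal.ofReal (‖ξ'‖ ^ (-(2*nu)) *
        ‖∫ t : ℝ, (q (fun j => Complex.I * ((app ξ' t) j : ℂ))) (g (app ξ' t))‖^2) ≤
      ENNReal.ofReal (C^2 * ∫ t : ℝ, ((1 + t^2) ^ (lam + 2*(k:ℝ)) : ℝ)) *
        ∫⁻ ξ : Rn (m+1), ENNReal.ofReal (‖ξ‖ ^ (-(2*lam)) * ‖g ξ‖^2) := by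
  set C' := ∫ t : ℝ, ((1 + t^2) ^ (lam + 2*(k:ℝ)) : ℝ) with hC'
  have hC'0 : 0 ≤ C' := integral_nonneg fun t => by positivity
  have hs : lam + 2*(k:ℝ) < -1/2 := by linarith
  have hW : AEMeasurable (fun ξ : Rn (m+1) => ENNReal.ofReal (‖ξ‖ ^ (-(2*lam)) * ‖g ξ‖^2))
      volume := by
    refine AEMeasurable.ennreal_ofReal ?_
    refine AEMeasurable.mul (by fun_prop) ?_
    exact hg.norm.aemeasurable.pow_const 2
  have hg2 := hg.comp_measurePreserving (mp_app m)
  have hW2 : AEMeasurable (fun z : Rn (m+1-1) × ℝ => ENNReal.ofReal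
      (‖(app z.1 z.2 : Rn (m+1))‖ ^ (-(2*lam)) * ‖g (app z.1 z.2)‖^2)) (volume.prod volume) := by
    have h := AEMeasurable.comp_quasiMeasurePreserving hW (mp_app m).quasiMeasurePreserving
    exact h
  have hF : ∫⁻ ξ : Rn (m+1), ENNReal.ofReal (‖ξ‖ ^ (-(2*lam)) * ‖g ξ‖^2) =
      ∫⁻ ξ' : Rn (m+1-1), ∫⁻ t : ℝ, ENNReal.ofReal
        (‖(app ξ' t : Rn (m+1))‖ ^ (-(2*lam)) * ‖g (app ξ' t)‖^2) := by
    rw [← lintegral_prod _ hW2]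
    conv_lhs => rw [← (mp_app m).map_eq]
    rw [lintegral_map' (by rw [(mp_app m).map_eq]; exact hW) (mp_app m).measurable.aemeasurable]
  rw [hF, ← lintegral_const_mul' _ _ ENNReal.ofReal_ne_top]
  refine lintegral_mono_ae ?_
  filter_upwards [hg2.prodMk_left] with x hx
  by_cases hx0 : x = 0
  · have : -(2*nu) ≠ 0 := by linarith
    simp [hx0, Real.zero_rpow this]
  have hr : 0 < ‖x‖ := norm_pos_iff.mpr hx0
  have hnapp : ∀ t : ℝ, 0 < ‖(app x t : Rn (m+1))‖ := by
    intro t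
    have := norm_app_sq m x t
    by_contra hcon
    have h0 : ‖(app x t : Rn (m+1))‖ = 0 := le_antisymm (not_lt.mp hcon) (norm_nonneg _)
    rw [h0] at this
    nlinarith [sq_nonneg t, pow_pos hr 2]
  have happm : Measurable (fun t : ℝ => ‖(app x t : Rn (m+1))‖) :=
    ((mp_app m).measurable.comp (measurable_const.prodMk measurable_id)).norm
  have hx' : AEMeasurable (fun t : ℝ => ‖g (app x t)‖) := hx.norm.aemeasurable
  -- Cauchy-Schwarz
  have h1 : ‖∫ t : ℝ, (q (fun j => Complex.I * ((app x t) j : ℂ))) (g (app x t))‖ₑ ≤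
      ENNReal.ofReal C * ∫⁻ t : ℝ, ENNReal.ofReal (‖(app x t : Rn (m+1))‖^(lam + 2*k)) *
        ENNReal.ofReal (‖(app x t : Rn (m+1))‖^(-lam) * ‖g (app x t)‖) := by
    rw [← lintegral_const_mul' _ _ ENNReal.ofReal_ne_top]
    refine (enorm_integral_le_lintegral_enorm _).trans (lintegral_mono fun t => ?_)
    rw [← ofReal_norm, ← ENNReal.ofReal_mul (by have := hnapp t; positivity),
      ← ENNReal.ofReal_mul hC0]
    refine ENNReal.ofReal_le_ofReal ?_
    refine (q_bound (m+1) k q hqpoly C hC _ (norm_pos_iff.mp (hnapp t)) _).trans_eq ?_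
    rw [← mul_assoc (_ ^ (lam + 2*(k:ℝ))), ← Real.rpow_add (hnapp t), ← mul_assoc]
    congr 2
    rw [← Real.rpow_natCast]
    congr 1
    push_cast; ring
  have h2 := lint_cs (fun t : ℝ => ENNReal.ofReal (‖(app x t : Rn (m+1))‖^(lam + 2*k)))
    (fun t : ℝ => ENNReal.ofReal (‖(app x t : Rn (m+1))‖^(-lam) * ‖g (app x t)‖))
    (happm.pow_const _).ennreal_ofReal.aemeasurable
    (((happm.pow_const _).aemeasurable.mul hx').ennreal_ofReal)
  have h3 : ∫⁻ t : ℝ, ENNReal.ofReal (‖(app x t : Rn (m+1))‖^(lam + 2*k))^2 =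
      ENNReal.ofReal (‖x‖^(2*nu) * C') := by
    have : 2 * nu = 2 * (lam + 2*(k:ℝ)) + 1 := by linarith
    rw [this, ← lint_weight _ _ hs hr]
    refine lintegral_congr fun t => ?_
    have := hnapp t
    rw [← ENNReal.ofReal_pow (by positivity), ← norm_app_sq]
    congr 1
    rw [← Real.rpow_natCast, ← Real.rpow_natCast, ← Real.rpow_mul this.le, ← Real.rpow_mul this.le,
      mul_comm]
  have h4 : ∫⁻ t : ℝ, ENNReal.ofReal (‖(app x t : Rn (m+1))‖^(-lam) * ‖g (app x t)‖)^2 =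
      ∫⁻ t : ℝ, ENNReal.ofReal (‖(app x t : Rn (m+1))‖ ^ (-(2*lam)) * ‖g (app x t)‖^2) := by
    refine lintegral_congr fun t => ?_
    have := hnapp t
    rw [← ENNReal.ofReal_pow (by positivity), mul_pow, ← Real.rpow_natCast, ← Real.rpow_mul this.le]
    congr 3
    push_cast; ring
  rw [h3, h4] at h2
  calc _ = ENNReal.ofReal (‖x‖ ^ (-(2*nu))) *
        ‖∫ t : ℝ, (q (fun j => Complex.I * ((app x t) j : ℂ))) (g (app x t))‖ₑ^2 := by
        rw [ENNReal.ofReal_mul (by positivity), ENNReal.ofReal_pow (norm_nonneg _), ofReal_norm]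
    _ ≤ ENNReal.ofReal (‖x‖ ^ (-(2*nu))) * (ENNReal.ofReal C ^2 *
        (ENNReal.ofReal (‖x‖^(2*nu) * C') * ∫⁻ t : ℝ, ENNReal.ofReal
          (‖(app x t : Rn (m+1))‖ ^ (-(2*lam)) * ‖g (app x t)‖^2))) := by
        gcongr
        refine (pow_le_pow_left' h1 2).trans ?_
        rw [mul_pow]
        gcongr
    _ = _ := by
        rw [← mul_assoc, ← mul_assoc, ← ENNReal.ofReal_pow hC0, ← ENNReal.ofReal_mul (by positivity),
          ← ENNReal.ofReal_mul (by positivity)]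
        congr 2
        have : ‖x‖ ^ (-(2*nu)) * ‖x‖^(2*nu) = 1 := by
          rw [← Real.rpow_add hr]; simp
        linear_combination (C^2 * C') * this

/-- consequence in terms of Bochner integrals -/
theorem key_int (m k : ℕ) (lam nu : ℝ) (hnu2 : nu < 0)
    (hk : lam + 1/2 - nu = -(2*(k:ℝ)))
    (q : (Fin (m+1) → ℂ) → (Lam (m+1) →ₗ[ℂ] Lam (m+1-1)))
    (hqpoly : ∀ (v : Lam (m+1)) (S : Finset (Fin (m+1-1))), ∃ P : MvPolynomial (Fin (m+1)) ℂ,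
      P.IsHomogeneous (2*k) ∧ ∀ ξ : Fin (m+1) → ℂ, (q ξ) v S = MvPolynomial.eval ξ P)
    (C : ℝ) (hC0 : 0 ≤ C)
    (hC : ∀ ξ : Rn (m+1), ‖ξ‖ = 1 → ∀ v : Lam (m+1),
      ‖(q (fun j => Complex.I * (ξ j : ℂ))) v‖ ≤ C * ‖v‖)
    (g : Rn (m+1) → Lam (m+1)) (hg : AEStronglyMeasurable g volume)
    (hgi : Integrable (fun ξ : Rn (m+1) => ‖ξ‖ ^ (-(2*lam)) * ‖g ξ‖^2)) :
    Integrable (fun ξ' : Rn (m+1-1) => ‖ξ'‖ ^ (-(2*nu)) *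
        ‖∫ t : ℝ, (q (fun j => Complex.I * ((app ξ' t) j : ℂ))) (g (app ξ' t))‖^2) ∧
    ∫ ξ' : Rn (m+1-1), ‖ξ'‖ ^ (-(2*nu)) *
        ‖∫ t : ℝ, (q (fun j => Complex.I * ((app ξ' t) j : ℂ))) (g (app ξ' t))‖^2 ≤
      C^2 * (∫ t : ℝ, ((1 + t^2) ^ (lam + 2*(k:ℝ)) : ℝ)) *
        ∫ ξ : Rn (m+1), ‖ξ‖ ^ (-(2*lam)) * ‖g ξ‖^2 := by
  have hC'0 : 0 ≤ ∫ t : ℝ, ((1 + t^2) ^ (lam + 2*(k:ℝ)) : ℝ) :=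
    integral_nonneg fun t => by positivity
  have hK := key m k lam nu hnu2 hk q hqpoly C hC0 hC g hg
  rw [← ofReal_integral_eq_lintegral_ofReal hgi
    (Filter.Eventually.of_forall fun t => by positivity), ← ENNReal.ofReal_mul (by positivity)] at hK
  have hm : AEStronglyMeasurable (fun ξ' : Rn (m+1-1) => ‖ξ'‖ ^ (-(2*nu)) *
        ‖∫ t : ℝ, (q (fun j => Complex.I * ((app ξ' t) j : ℂ))) (g (app ξ' t))‖^2) volume := by
    refine AEStronglyMeasurable.mul ?_ ((q_comp_meas m k q hqpoly g hg).norm.pow 2)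
    exact Measurable.aestronglyMeasurable (by fun_prop)
  refine ⟨⟨hm, ?_⟩, ?_⟩
  · rw [hasFiniteIntegral_iff_ofReal (Filter.Eventually.of_forall fun t => by positivity)]
    exact hK.trans_lt ENNReal.ofReal_lt_top
  · rw [integral_eq_lintegral_of_nonneg_ae (Filter.Eventually.of_forall fun t => by positivity) hm]
    refine ENNReal.toReal_le_of_le_ofReal ?_ hK
    have : 0 ≤ ∫ ξ : Rn (m+1), ‖ξ‖ ^ (-(2*lam)) * ‖g ξ‖^2 :=
      integral_nonneg fun t => by positivity
    positivity

theorem ft_eq (n : ℕ) (u : SchwartzMap (Rn n) (Lam n)) (ξ : Rn n) :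
    ft (fun x => u x) ξ = ((2 * Real.pi) ^ (-(n:ℝ)/2) : ℝ) •
      (FourierTransform.fourier u : SchwartzMap (Rn n) (Lam n)) ((2 * Real.pi)⁻¹ • ξ) := by
  rw [SchwartzMap.fourier_coe, Real.fourier_eq']
  unfold ft
  congr 2
  funext x
  congr 2
  rw [inner_smul_right]
  have h1 : (inner ℝ x ξ : ℝ) = ∑ j, x j * ξ j := by
    simp [PiLp.inner_apply, mul_comm]
  rw [h1]
  have : -2 * Real.pi * ((2 * Real.pi)⁻¹ * ∑ j, x j * ξ j) = - ∑ j, x j * ξ j := by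
    have := Real.pi_pos.ne'
    field_simp
  rw [this]
  push_cast
  ring

theorem schwartz_int (n : ℕ) (h : SchwartzMap (Rn n) (Lam n)) (s : ℝ) (hs : 0 ≤ s) :
    Integrable (fun x : Rn n => ‖x‖^s * ‖h x‖^2) := by
  obtain ⟨N, hN⟩ := exists_nat_ge s
  obtain ⟨M, hM0, hM⟩ := h.decay 0 0
  have hM' : ∀ x, ‖h x‖ ≤ M := fun x => by simpa using hM x
  have h0 := h.integrable_pow_mul volume 0
  have h1 := h.integrable_pow_mul volume N
  refine ((h0.add h1).const_mul M).mono' ?_ (Filter.Eventually.of_forall fun x => ?_)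
  · exact ((continuous_norm.rpow_const fun _ => Or.inr hs).mul
      (h.continuous.norm.pow 2)).aestronglyMeasurable
  · have hx : ‖x‖^s ≤ 1 + ‖x‖^N := by
      rcases le_total ‖x‖ 1 with hx | hx
      · have := Real.rpow_le_one (norm_nonneg x) hx hs
        have : 0 ≤ ‖x‖^N := by positivity
        linarith
      · have := Real.rpow_le_rpow_of_exponent_le hx hN
        rw [Real.rpow_natCast] at this
        linarith
    rw [Real.norm_of_nonneg (by positivity)]
    calc ‖x‖^s * ‖h x‖^2 ≤ (1 + ‖x‖^N) * (M * ‖h x‖) := by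
          rw [pow_two]
          gcongr
          exact hM' x
      _ = _ := by simp; ring

theorem ft_nice (n : ℕ) (u : SchwartzMap (Rn n) (Lam n)) (s : ℝ) (hs : 0 ≤ s) :
    AEStronglyMeasurable (ft (fun x => u x)) volume ∧
    Integrable (fun ξ : Rn n => ‖ξ‖^s * ‖ft (fun x => u x) ξ‖^2) := by
  have hpi := Real.pi_pos
  constructor
  · rw [funext (ft_eq n u)]
    refine Continuous.aestronglyMeasurable ?_
    have := (FourierTransform.fourier u : SchwartzMap (Rn n) (Lam n)).continuous
    fun_prop
  · have h1 := ((schwartz_int n (FourierTransform.fourier u) s hs).comp_smul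
      (R := (2 * Real.pi)⁻¹) (by positivity)).const_mul
      ((2*Real.pi)^s * ((2 * Real.pi) ^ (-(n:ℝ)/2))^2)
    refine h1.congr (Filter.Eventually.of_forall fun ξ => ?_)
    simp only [ft_eq]
    rw [norm_smul, norm_smul, Real.norm_of_nonneg (by positivity), Real.norm_of_nonneg (by positivity),
      Real.mul_rpow (x := (2 * Real.pi)⁻¹) (by positivity) (by positivity),
      Real.inv_rpow (by positivity)]
    have : (2*Real.pi)^s ≠ 0 := by positivity
    field_simp

theorem isForm_integral (d p : ℕ) (f : ℝ → Lam d) (hf : ∀ t, IsForm p (f t)) :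
    IsForm p (∫ t, f t) := by
  intro S hS
  by_cases hi : Integrable f
  · have := (EuclideanSpace.proj S : Lam d →L[ℂ] ℂ).integral_comp_comm hi
    refine this.symm.trans ?_
    exact (integral_congr_ae (Filter.Eventually.of_forall fun t => hf t S hS)).trans (by simp)
  · rw [integral_undef hi]; rfl

/-- continuity of differential symmetry breaking operators. q is a
Hom(Λ^pℂ^n, Λ^pℂ^{n-1})-valued homogeneous polynomial of degree 2k; C bounds the operator
norms ‖q(iξ)‖ over the unit sphere and C' = ∫ (1+t²)^{λ+2k} dt. Then for every Schwartz
p-form u: ∫ |ξ'|^{-2ν} ‖∫ q(iξ) û(ξ',ξ_n) dξ_n‖² dξ' ≤ 2π C² C' ∫ |ξ|^{-2λ} ‖û‖² dξ, and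
consequently u ↦ (q(∂)u)|_{x_n=0} extends to a continuous linear operator
Ḣ^{-λ,p}(ℝ^n) → Ḣ^{-ν,p}(ℝ^{n-1}) (expressed on the Fourier side). -/
theorem stmt2 (n p k : ℕ) (hn : 2 ≤ n) (hp : 2*p ≤ n)
    (lam nu : ℝ) (hlam1 : -(n:ℝ)/2 + p < lam) (hlam2 : lam < 0)
    (hnu1 : -((n:ℝ)-1)/2 + p < nu) (hnu2 : nu < 0)
    (hk : lam + 1/2 - nu = -(2*(k:ℝ)))
    (q : (Fin n → ℂ) → (Lam n →ₗ[ℂ] Lam (n-1)))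
    (hqpoly : ∀ (v : Lam n) (S : Finset (Fin (n-1))), ∃ P : MvPolynomial (Fin n) ℂ,
      P.IsHomogeneous (2*k) ∧ ∀ ξ : Fin n → ℂ, (q ξ) v S = MvPolynomial.eval ξ P)
    (hqdeg : ∀ (ξ : Fin n → ℂ) (v : Lam n), IsForm p v → IsForm p ((q ξ) v))
    (C : ℝ)
    (hC : ∀ ξ : Rn n, ‖ξ‖ = 1 → ∀ v : Lam n, ‖(q (fun j => Complex.I * (ξ j : ℂ))) v‖ ≤ C * ‖v‖) :
    -- the a priori inequality for Schwartz p-forms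
    (∀ u : SchwartzMap (Rn n) (Lam n), (∀ x, IsForm p (u x)) →
      (∫ ξ' : Rn (n-1), ‖ξ'‖ ^ (-(2*nu)) *
          ‖∫ t : ℝ, (q (fun j => Complex.I * ((app ξ' t) j : ℂ))) (ft (fun x => u x) (app ξ' t))‖^2)
        ≤ 2 * Real.pi * C^2 * (∫ t : ℝ, ((1 + t^2) ^ (lam + 2*(k:ℝ)) : ℝ)) *
            ∫ ξ : Rn n, ‖ξ‖ ^ (-(2*lam)) * ‖ft (fun x => u x) ξ‖^2) ∧
    -- consequently the operator extends continuously to the homogeneous Sobolev spaces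
    (∀ g ∈ Hdot n (-lam) p,
      (fun ξ' : Rn (n-1) => ((2*Real.pi) ^ (-(1:ℝ)/2) : ℝ) •
          ∫ t : ℝ, (q (fun j => Complex.I * ((app ξ' t) j : ℂ))) (g (app ξ' t)))
        ∈ Hdot (n-1) (-nu) p ∧
      wInt (-(2*nu)) (fun ξ' : Rn (n-1) => ((2*Real.pi) ^ (-(1:ℝ)/2) : ℝ) •
          ∫ t : ℝ, (q (fun j => Complex.I * ((app ξ' t) j : ℂ))) (g (app ξ' t)))
        ≤ C^2 * (∫ t : ℝ, ((1 + t^2) ^ (lam + 2*(k:ℝ)) : ℝ)) * wInt (-(2*lam)) g) := by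
  obtain ⟨m, rfl⟩ : ∃ m, n = m + 1 := ⟨n - 1, by omega⟩
  have hC0 : 0 ≤ C := by
    have h := hC (EuclideanSpace.single 0 1) (by simp) (EuclideanSpace.single ∅ 1)
    have h2 := (norm_nonneg _).trans h
    simpa using h2
  have hC'0 : 0 ≤ ∫ t : ℝ, ((1 + t^2) ^ (lam + 2*(k:ℝ)) : ℝ) :=
    integral_nonneg fun t => by positivity
  refine ⟨fun u _ => ?_, fun g hg => ?_⟩
  · obtain ⟨hm, hi⟩ := ft_nice (m+1) u (-(2*lam)) (by linarith)
    refine (key_int m k lam nu hnu2 hk q hqpoly C hC0 hC _ hm hi).2.trans ?_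
    have h0 : 0 ≤ ∫ ξ : Rn (m+1), ‖ξ‖ ^ (-(2*lam)) * ‖ft (fun x => u x) ξ‖^2 :=
      integral_nonneg fun t => by positivity
    gcongr
    have := Real.pi_gt_three
    nlinarith [sq_nonneg C]
  · obtain ⟨hm, hform, hi⟩ := hg
    have e1 : ∀ s : ℝ, 2 * -s = -(2*s) := fun s => by ring
    rw [e1] at hi
    obtain ⟨k1, k2⟩ := key_int m k lam nu hnu2 hk q hqpoly C hC0 hC g hm hi
    set c : ℝ := ((2*Real.pi) ^ (-(1:ℝ)/2) : ℝ) with hc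
    have hc0 : 0 ≤ c := by positivity
    have hc1 : c^2 ≤ 1 := by
      have : c ≤ 1 := Real.rpow_le_one_of_one_le_of_nonpos
        (by have := Real.pi_gt_three; linarith) (by norm_num)
      nlinarith
    have hn : ∀ (x : Rn (m+1-1)) (w : Lam (m+1-1)), ‖x‖ ^ (-(2*nu)) * ‖c • w‖^2 =
        c^2 * (‖x‖ ^ (-(2*nu)) * ‖w‖^2) := by
      intro x w
      rw [norm_smul, Real.norm_of_nonneg hc0]; ring
    refine ⟨⟨?_, ?_, ?_⟩, ?_⟩
    · exact (q_comp_meas m k q hqpoly g hm).const_smul c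
    · intro ξ' S hS
      have := isForm_integral (m+1-1) p _ (fun t => hqdeg
        (fun j => Complex.I * ((app ξ' t) j : ℂ)) _ (hform (app ξ' t))) S hS
      rw [PiLp.smul_apply, this, smul_zero]
    · rw [e1]
      simp only [hn]
      exact k1.const_mul _
    · unfold wInt
      simp only [hn]
      rw [integral_const_mul]
      refine le_trans ?_ k2
      exact mul_le_of_le_one_left (integral_nonneg fun t => by positivity) hc1
end
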